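/- Let n ≥ 2, 1 < p ≤ q, α ∈ (0,1], μ ∈ [0,1], 0 < ν ≤ L and A ≥ 1. Let Ω ⊆ ℝⁿ be open and let B_ρ = B_ρ(x₀) be an open ball with ρ ∈ (0,1] whose closure is contained in Ω. Let F : Ω × ℝⁿ → ℝ be such that for each x the map z ↦ F(x,z) is continuously differentiable, and write A(x,z) := ∂_z F(x,z); assume A is measurable in x, and that for all x, x₁, x₂ ∈ Ω and all z, z₁, z₂ ∈ ℝⁿ with z₁ ≠ z₂: (i) (A(x,z₁) − A(x,z₂))·(z₁ − z₂) ≥ ν (μ² + |z₁|² + |z₂|²)^{(p−2)/2} |z₁ − z₂|²; (ii) |A(x,z)| ≤ L (1 + |z|²)^{(q−1)/2}; (iii) |A(x₁,z) − A(x₂,z)| ≤ L |x₁ − x₂|^α (1 + |z|²)^{(q−1)/2}. Let ψ, v : Ω → ℝ be continuously differentiable with v(x) ≥ ψ(x) for all x ∈ B_ρ and ∫_{B_ρ} (|Dv|^q + |Dψ|^q) dx < ∞. Assume the variational inequality ∫_{B_ρ} A(x,Dv)·(Dw − Dv) dx ≥ 0 holds for every continuously differentiable w : B_ρ → ℝ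 with w ≥ ψ on B_ρ and w = v outside a compact subset of B_ρ. Assume moreover that (∫_{B_ρ} |Dψ(x+h) − Dψ(x)|^q dx)^{1/q} ≤ A |h|^α for every h ∈ ℝⁿ with 0 < |h| < (1/4)·dist(closure(B_ρ), ℝⁿ \ Ω). Then there exists a constant c > 0, depending only on n, ν, L, p, q, α and A, such that for all radii ρ/2 ≤ t < s ≤ ρ and every h ∈ ℝⁿ with 0 < |h| < (1/1000)·min{s − t, dist(closure(B_ρ), ℝⁿ \ Ω)} one has ∫_{B_t} |V_{μ,p}(Dv(x+h)) − V_{μ,p}(Dv(x))|² dx ≤ c |h|^α (s − t)^{−1} [1 + ∫_{B_s} (|Dv|^q + |Dψ|^q) dx], where B_t, B_s are balls concentric with B_ρ. -/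

import Mathlib

open MeasureTheory Metric
open scoped RealInnerProductSpace

/-- The distance between two sets, `dist(A,B) = inf {dist a b : a ∈ A, b ∈ B}`. -/
noncomputable def distSet {α : Type*} [PseudoMetricSpace α] (A B : Set α) : ℝ :=
  sInf (Set.image2 dist A B)

/-- The auxiliary vector field `V_{μ,t}(z) = (μ² + |z|²)^((t-2)/4) z`. -/
noncomputable def Vmap {n : ℕ} (μ t : ℝ) (z : EuclideanSpace ℝ (Fin n)) :
    EuclideanSpace ℝ (Fin n) :=
  (μ ^ 2 + ‖z‖ ^ 2) ^ ((t - 2) / 4) • z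

lemma aux_one_sub_rpow (e σ : ℝ) (he : 0 < e) (h0 : 0 < σ) (h1 : σ ≤ 1) :
    1 - σ ^ e ≤ max 1 e * (1 - σ) := by
  rcases le_total e 1 with h | h
  · have : σ ^ (1:ℝ) ≤ σ ^ e := Real.rpow_le_rpow_of_exponent_ge h0 h1 h
    rw [Real.rpow_one] at this
    rw [max_eq_left h]; linarith
  · have := one_add_mul_self_le_rpow_one_add (s := σ - 1) (by linarith) h
    rw [max_eq_right h]
    have e1 : 1 + (σ - 1) = σ := by ring
    rw [e1] at this
    linarith

lemma aux_sigma (p σ : ℝ) (hp : 1 < p) (h0 : 0 < σ) (h1 : σ ≤ 1) :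
    |1 - σ ^ ((p - 2) / 2)| * σ ≤ p * (1 - σ) := by
  have e1 : |1 - σ ^ ((p - 2) / 2)| * σ = |σ - σ ^ (p / 2)| := by
    rw [← abs_of_pos h0, ← abs_mul, abs_of_pos h0]
    congr 1
    have : σ ^ (p/2) = σ ^ ((p-2)/2) * σ := by
      rw [← Real.rpow_add_one h0.ne']; congr 1; ring
    rw [this]; ring
  rw [e1]
  have h2 := aux_one_sub_rpow (p/2) σ (by linarith) h0 h1
  have h3 : max 1 (p/2) ≤ p := max_le hp.le (by linarith)
  have h4 : max 1 (p/2) * (1 - σ) ≤ p * (1-σ) :=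
    mul_le_mul_of_nonneg_right h3 (by linarith)
  have h5 : σ ^ (p/2) ≤ 1 := Real.rpow_le_one h0.le h1 (by linarith)
  have h6 : 1 * (1-σ) ≤ p * (1-σ) := mul_le_mul_of_nonneg_right hp.le (by linarith)
  rw [abs_le]; constructor <;> linarith

/-- scalar estimate for the coefficient of `V`. -/
lemma aux_coef (p μ a b : ℝ) (hp : 1 < p) (hb : 0 ≤ b) (hab : b ≤ a) :
    |(μ ^ 2 + a ^ 2) ^ ((p - 2) / 4) - (μ ^ 2 + b ^ 2) ^ ((p - 2) / 4)| * b ≤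
      p * (μ ^ 2 + a ^ 2) ^ ((p - 2) / 4) * (a - b) := by
  rcases hb.eq_or_lt with rfl | hb
  · simp; positivity
  have ha : 0 < a := by linarith
  set X := √(μ ^ 2 + a ^ 2) with hX
  set Y := √(μ ^ 2 + b ^ 2) with hY
  have hX0 : 0 < X := by positivity
  have hY0 : 0 < Y := by positivity
  have hX2 : X ^ 2 = μ ^ 2 + a ^ 2 := Real.sq_sqrt (by positivity)
  have hY2 : Y ^ 2 = μ ^ 2 + b ^ 2 := Real.sq_sqrt (by positivity)
  have hYX : Y ≤ X := Real.sqrt_le_sqrt (by nlinarith)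
  have hbY : b ≤ Y := Real.le_sqrt_of_sq_le (by nlinarith)
  have haX : a ≤ X := Real.le_sqrt_of_sq_le (by nlinarith)
  have hd : X - Y ≤ a - b := by
    have : (X - Y) * (X + Y) = (a - b) * (a + b) := by nlinarith
    have h2 : (a - b) * (a + b) ≤ (a - b) * (X + Y) :=
      mul_le_mul_of_nonneg_left (by linarith) (by linarith)
    exact le_of_mul_le_mul_right (by linarith) (by linarith : 0 < X + Y)
  have hpow : ∀ Z : ℝ, 0 < Z → (Z ^ 2) ^ ((p - 2) / 4) = Z ^ ((p - 2) / 2) := by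
    intro Z hZ
    rw [← Real.rpow_natCast, ← Real.rpow_mul hZ.le]; congr 1; push_cast; ring
  rw [← hX2, ← hY2, hpow X hX0, hpow Y hY0]
  have hs := aux_sigma p (Y / X) hp (by positivity) ((div_le_one hX0).2 hYX)
  rw [Real.div_rpow hY0.le hX0.le] at hs
  set x := X ^ ((p - 2) / 2)
  set y := Y ^ ((p - 2) / 2)
  have hx0 : 0 < x := by positivity
  have e1 : |x - y| = |1 - y / x| * x := by
    rw [← abs_of_pos hx0, ← abs_mul, abs_of_pos hx0]; congr 1; field_simp
  calc |x - y| * b ≤ |x - y| * Y := by gcongr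
    _ = (|1 - y/x| * (Y/X)) * (x * X) := by rw [e1]; field_simp
    _ ≤ (p * (1 - Y/X)) * (x * X) := by gcongr
    _ = p * x * (X - Y) := by field_simp
    _ ≤ p * x * (a - b) := by gcongr

lemma V_le' {n : ℕ} (p μ : ℝ) (hp : 1 < p) (z₁ z₂ : EuclideanSpace ℝ (Fin n))
    (h12 : z₁ ≠ z₂) (hle : ‖z₂‖ ≤ ‖z₁‖) :
    ‖Vmap μ p z₁ - Vmap μ p z₂‖ ^ 2 ≤ (1 + p) ^ 2 * 2 ^ (|p - 2| / 2) *
      ((μ ^ 2 + ‖z₁‖ ^ 2 + ‖z₂‖ ^ 2) ^ ((p - 2) / 2) * ‖z₁ - z₂‖ ^ 2) := by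
  have hz1 : 0 < ‖z₁‖ := by
    rcases (norm_nonneg z₁).eq_or_lt with h | h
    · exfalso
      apply h12
      have h2 : ‖z₂‖ = 0 := le_antisymm (by linarith) (norm_nonneg _)
      rw [norm_eq_zero.1 h.symm, norm_eq_zero.1 h2]
    · exact h
  have hc := aux_coef p μ ‖z₁‖ ‖z₂‖ hp (norm_nonneg _) hle
  set X := μ ^ 2 + ‖z₁‖ ^ 2 with hX
  have hX0 : 0 < X := by positivity
  set f := X ^ ((p - 2) / 4) with hf
  set g := (μ ^ 2 + ‖z₂‖ ^ 2) ^ ((p - 2) / 4) with hg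
  have hf0 : 0 < f := by positivity
  have e : Vmap μ p z₁ - Vmap μ p z₂ = f • (z₁ - z₂) + (f - g) • z₂ := by
    simp only [Vmap, ← hX, ← hf, ← hg]; module
  have hn : ‖Vmap μ p z₁ - Vmap μ p z₂‖ ≤ (1 + p) * f * ‖z₁ - z₂‖ := by
    rw [e]
    have h1 : ‖z₁‖ - ‖z₂‖ ≤ ‖z₁ - z₂‖ := norm_sub_norm_le _ _
    calc _ ≤ ‖f • (z₁ - z₂)‖ + ‖(f - g) • z₂‖ := norm_add_le _ _
      _ = f * ‖z₁ - z₂‖ + |f - g| * ‖z₂‖ := by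
        rw [norm_smul, norm_smul, Real.norm_eq_abs, Real.norm_eq_abs, abs_of_pos hf0]
      _ ≤ f * ‖z₁ - z₂‖ + p * f * ‖z₁ - z₂‖ := by
        have : p * f * (‖z₁‖ - ‖z₂‖) ≤ p * f * ‖z₁ - z₂‖ := by gcongr
        linarith
      _ = _ := by ring
  have hf2 : f ^ 2 = X ^ ((p - 2) / 2) := by
    rw [hf, ← Real.rpow_natCast, ← Real.rpow_mul hX0.le]; congr 1; push_cast; ring
  set S := μ ^ 2 + ‖z₁‖ ^ 2 + ‖z₂‖ ^ 2 with hS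
  have hXS : X ≤ S := by simp only [hX, hS]; nlinarith [norm_nonneg z₂]
  have hSX : S ≤ 2 * X := by
    simp only [hX, hS]; nlinarith [norm_nonneg z₂, sq_nonneg μ]
  have hS0 : 0 < S := by linarith
  have key : X ^ ((p - 2) / 2) ≤ 2 ^ (|p - 2| / 2) * S ^ ((p - 2) / 2) := by
    rcases le_total 0 (p - 2) with h | h
    · have h1 : X ^ ((p-2)/2) ≤ S ^ ((p-2)/2) := Real.rpow_le_rpow hX0.le hXS (by linarith)
      have h2 : (1:ℝ) ≤ 2 ^ (|p - 2| / 2) := Real.one_le_rpow (by norm_num) (by positivity)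
      have h3 : 0 < S ^ ((p-2)/2) := by positivity
      nlinarith
    · rw [abs_of_nonpos h]
      have h1 : (2 * X) ^ ((p-2)/2) ≤ S ^ ((p-2)/2) :=
        Real.rpow_le_rpow_of_nonpos hS0 hSX (by linarith)
      rw [Real.mul_rpow (by norm_num) hX0.le] at h1
      have h2 : (2:ℝ) ^ (-(p-2)/2) * 2 ^ ((p-2)/2) = 1 := by
        rw [← Real.rpow_add (by norm_num)]
        have : -(p-2)/2 + (p-2)/2 = 0 := by ring
        rw [this, Real.rpow_zero]
      calc X ^ ((p-2)/2) = (2:ℝ) ^ (-(p-2)/2) * (2 ^ ((p-2)/2) * X ^ ((p-2)/2)) := by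
            rw [← mul_assoc, h2, one_mul]
        _ ≤ _ := by gcongr
  calc ‖Vmap μ p z₁ - Vmap μ p z₂‖ ^ 2 ≤ ((1 + p) * f * ‖z₁ - z₂‖) ^ 2 := by gcongr
    _ = (1 + p) ^ 2 * X ^ ((p - 2) / 2) * ‖z₁ - z₂‖ ^ 2 := by rw [← hf2]; ring
    _ ≤ (1 + p) ^ 2 * (2 ^ (|p - 2| / 2) * S ^ ((p - 2) / 2)) * ‖z₁ - z₂‖ ^ 2 := by gcongr
    _ = _ := by ring

lemma V_le {n : ℕ} (p μ : ℝ) (hp : 1 < p) (z₁ z₂ : EuclideanSpace ℝ (Fin n))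
    (h12 : z₁ ≠ z₂) :
    ‖Vmap μ p z₁ - Vmap μ p z₂‖ ^ 2 ≤ (1 + p) ^ 2 * 2 ^ (|p - 2| / 2) *
      ((μ ^ 2 + ‖z₁‖ ^ 2 + ‖z₂‖ ^ 2) ^ ((p - 2) / 2) * ‖z₁ - z₂‖ ^ 2) := by
  rcases le_total ‖z₂‖ ‖z₁‖ with h | h
  · exact V_le' p μ hp z₁ z₂ h12 h
  · have := V_le' p μ hp z₂ z₁ h12.symm h
    rw [norm_sub_rev, norm_sub_rev z₁ z₂, add_right_comm]
    exact this

lemma aux_mul_rpow (q a b : ℝ) (hq : 1 < q) (ha : 0 ≤ a) (hb : 0 ≤ b) :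
    a ^ (q - 1) * b ≤ a ^ q + b ^ q := by
  have e : ∀ c : ℝ, 0 ≤ c → c ^ q = c ^ (q - 1) * c := by
    intro c hc
    rw [← Real.rpow_add_one' hc (by linarith)]; congr 1; ring
  rcases le_total a b with h | h
  · have h1 : a ^ (q-1) ≤ b ^ (q-1) := Real.rpow_le_rpow ha h (by linarith)
    have h2 : 0 ≤ a ^ q := by positivity
    rw [e b hb]; nlinarith
  · have h1 : 0 ≤ a ^ (q-1) := by positivity
    have h2 : 0 ≤ b ^ q := by positivity
    rw [e a ha]; nlinarith

lemma aux_growth (q a : ℝ) (hq : 1 < q) (ha : 0 ≤ a) :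
    (1 + a ^ 2) ^ ((q - 1) / 2) ≤ (1 + a) ^ (q - 1) := by
  have h : (1 + a) ^ (q - 1) = ((1 + a) ^ 2) ^ ((q - 1) / 2) := by
    rw [← Real.rpow_natCast, ← Real.rpow_mul (by linarith)]; congr 1; push_cast; ring
  rw [h]
  apply Real.rpow_le_rpow (by positivity) (by nlinarith) (by linarith)

lemma aux_m (q a b : ℝ) (hq : 1 < q) (ha : 0 ≤ a) (hb : 0 ≤ b) :
    (2 + a + b) ^ q ≤ 4 ^ q * (1 + a ^ q + b ^ q) := by
  set M := max 1 (max a b) with hM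
  have h1 : 1 ≤ M := le_max_left _ _
  have h2 : a ≤ M := (le_max_left _ _).trans (le_max_right _ _)
  have h3 : b ≤ M := (le_max_right _ _).trans (le_max_right _ _)
  have h4 : M ^ q ≤ 1 + a ^ q + b ^ q := by
    have ha' : 0 ≤ a ^ q := by positivity
    have hb' : 0 ≤ b ^ q := by positivity
    rcases max_choice 1 (max a b) with h | h
    · rw [hM, h, Real.one_rpow]; linarith
    · rcases max_choice a b with h' | h' <;> rw [hM, h, h'] <;> linarith
  calc (2 + a + b) ^ q ≤ (4 * M) ^ q := Real.rpow_le_rpow (by positivity) (by linarith) (by linarith)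
    _ = 4 ^ q * M ^ q := Real.mul_rpow (by norm_num) (by linarith)
    _ ≤ _ := by gcongr

lemma aux_sub (q a b c : ℝ) (hq : 1 < q) (ha : 0 ≤ a) (hb : 0 ≤ b) (hc : 0 ≤ c)
    (h : c ≤ a + b) : c ^ q ≤ 2 ^ q * (a ^ q + b ^ q) := by
  have ha' : 0 ≤ a ^ q := by positivity
  have hb' : 0 ≤ b ^ q := by positivity
  have h4 : (max a b) ^ q ≤ a ^ q + b ^ q := by
    rcases max_choice a b with h' | h' <;> rw [h'] <;> linarith
  calc c ^ q ≤ (2 * max a b) ^ q := Real.rpow_le_rpow hc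
        (by linarith [le_max_left a b, le_max_right a b]) (by linarith)
    _ = 2 ^ q * (max a b) ^ q := Real.mul_rpow (by norm_num) (le_max_of_le_left ha)
    _ ≤ _ := by gcongr

lemma st_deriv_zero_left (y : ℝ) (hy : y ≤ 0) : deriv Real.smoothTransition y = 0 := by
  apply IsLocalMin.deriv_eq_zero
  refine Filter.Eventually.of_forall fun z => ?_
  rw [Real.smoothTransition.zero_of_nonpos hy]
  exact Real.smoothTransition.nonneg z

lemma st_deriv_zero_right (y : ℝ) (hy : 1 ≤ y) : deriv Real.smoothTransition y = 0 := by
  apply IsLocalMax.deriv_eq_zero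
  refine Filter.Eventually.of_forall fun z => ?_
  rw [Real.smoothTransition.one_of_one_le hy]
  exact Real.smoothTransition.le_one z

lemma st_deriv_bound : ∃ M : ℝ, 0 < M ∧ ∀ y, |deriv Real.smoothTransition y| ≤ M := by
  have hc : Continuous (deriv Real.smoothTransition) :=
    (Real.smoothTransition.contDiff (n := 1)).continuous_deriv (by simp)
  obtain ⟨C, hC⟩ := (isCompact_Icc (a := (0:ℝ)) (b := 1)).exists_bound_of_continuousOn
    hc.continuousOn
  refine ⟨max C 1, by positivity, fun y => ?_⟩
  by_cases h0 : y ≤ 0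
  · rw [st_deriv_zero_left y h0]; simp
  by_cases h1 : 1 ≤ y
  · rw [st_deriv_zero_right y h1]; simp
  push Not at h0 h1
  exact (hC y ⟨h0.le, h1.le⟩).trans (le_max_left _ _)

lemma cutoff : ∃ M : ℝ, 0 < M ∧ ∀ (n : ℕ) (x₀ : EuclideanSpace ℝ (Fin n)) (t R : ℝ),
    0 < t → t < R → ∃ η : EuclideanSpace ℝ (Fin n) → ℝ, ContDiff ℝ 1 η ∧
      (∀ x, 0 ≤ η x) ∧ (∀ x, η x ≤ 1) ∧ (∀ x ∈ ball x₀ t, η x = 1) ∧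
      (∀ x ∉ ball x₀ R, η x = 0) ∧ (∀ x ∉ ball x₀ R, gradient η x = 0) ∧
      ∀ x, ‖gradient η x‖ ≤ M / (R - t) := by
  obtain ⟨M, hM, hMb⟩ := st_deriv_bound
  refine ⟨2 * M, by positivity, fun n x₀ t R ht htR => ?_⟩
  have hD : 0 < R ^ 2 - t ^ 2 := by nlinarith
  set y : EuclideanSpace ℝ (Fin n) → ℝ := fun x => (R ^ 2 - ‖x - x₀‖ ^ 2) / (R ^ 2 - t ^ 2)
    with hy
  have hyC : ContDiff ℝ 1 y := by
    apply ContDiff.div_const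
    apply contDiff_const.sub
    exact (contDiff_id.sub contDiff_const).norm_sq ℝ
  have hout : ∀ x ∉ ball x₀ R, y x ≤ 0 := by
    intro x hx
    rw [mem_ball, dist_eq_norm, not_lt] at hx
    apply div_nonpos_of_nonpos_of_nonneg _ hD.le
    nlinarith
  have hgrad : ∀ x, HasGradientAt (fun x => Real.smoothTransition (y x))
      ((deriv Real.smoothTransition (y x) * (-2 / (R ^ 2 - t ^ 2))) • (x - x₀)) x := by
    intro x
    rw [hasGradientAt_iff_hasFDerivAt]
    have h1 : HasFDerivAt (fun x : EuclideanSpace ℝ (Fin n) => ‖x - x₀‖ ^ 2)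
      (2 • (innerSL ℝ (x - x₀))) x := by
      have := ((hasFDerivAt_id x).sub_const x₀).norm_sq
      simpa using this
    have h2 := (h1.const_sub (R ^ 2)).mul_const ((R ^ 2 - t ^ 2)⁻¹)
    have h3 : HasDerivAt Real.smoothTransition (deriv Real.smoothTransition (y x)) (y x) :=
      ((Real.smoothTransition.contDiff (n := 1)).differentiable (by simp) _).hasDerivAt
    have h4 := HasDerivAt.comp_hasFDerivAt x (h₂ := Real.smoothTransition) h3 h2
    refine h4.congr_fderiv ?_
    ext z
    simp
    field_simp
  refine ⟨fun x => Real.smoothTransition (y x), (Real.smoothTransition.contDiff (n := 1)).comp hyC,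
    fun x => Real.smoothTransition.nonneg _, fun x => Real.smoothTransition.le_one _, ?_, ?_, ?_, ?_⟩
  · intro x hx
    apply Real.smoothTransition.one_of_one_le
    rw [mem_ball, dist_eq_norm] at hx
    rw [hy, le_div_iff₀ hD]
    nlinarith [norm_nonneg (x - x₀)]
  · intro x hx
    exact Real.smoothTransition.zero_of_nonpos (hout x hx)
  · intro x hx
    rw [(hgrad x).gradient, st_deriv_zero_left _ (hout x hx)]; simp
  · intro x
    rw [(hgrad x).gradient]
    by_cases hx : x ∈ ball x₀ R
    · rw [mem_ball, dist_eq_norm] at hx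
      rw [norm_smul, norm_mul, Real.norm_eq_abs, norm_div, Real.norm_eq_abs, Real.norm_eq_abs,
        abs_of_pos hD]
      have : |(-2:ℝ)| = 2 := by norm_num
      rw [this]
      have h1 : 2 / (R ^ 2 - t ^ 2) * R ≤ 2 / (R - t) := by
        have : R ^ 2 - t ^ 2 = (R - t) * (R + t) := by ring
        rw [this, div_mul_eq_mul_div, div_le_div_iff₀ (by nlinarith) (by linarith)]
        nlinarith [mul_pos (sub_pos.2 htR) ht]
      calc _ ≤ M * (2 / (R ^ 2 - t ^ 2)) * R := by
            gcongr
            exact hMb _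
        _ = M * (2 / (R ^ 2 - t ^ 2) * R) := by ring
        _ ≤ M * (2 / (R - t)) := by gcongr
        _ = _ := by ring
    · rw [st_deriv_zero_left _ (hout x hx)]; simp
      have : 0 < R - t := by linarith
      positivity

lemma translate_le {n : ℕ} (x₀ k : EuclideanSpace ℝ (Fin n)) (R s : ℝ) (hRs : R + ‖k‖ ≤ s)
    (f : EuclideanSpace ℝ (Fin n) → ℝ) (hf : ContinuousOn f (closedBall x₀ s))
    (hf0 : ∀ x, 0 ≤ f x) :
    ∫ x in ball x₀ R, f (x + k) ≤ ∫ x in ball x₀ s, f x := by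
  have hfs : IntegrableOn f (ball x₀ s) :=
    (hf.integrableOn_compact (isCompact_closedBall x₀ s)).mono_set ball_subset_closedBall
  have e1 : ∫ x in ball x₀ R, f (x + k) = ∫ x in ball (x₀ + k) R, f x := by
    rw [← integral_indicator measurableSet_ball, ← integral_indicator measurableSet_ball,
      ← integral_add_right_eq_self ((ball (x₀ + k) R).indicator f) k]
    congr 1
    ext x
    simp only [Set.indicator, mem_ball, dist_add_right]
  rw [e1]
  apply setIntegral_mono_set hfs (Filter.Eventually.of_forall hf0)
  apply LE.le.eventuallyLE
  intro x hx
  rw [mem_ball, dist_eq_norm] at hx ⊢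
  have e : x - x₀ = (x - (x₀ + k)) + k := by abel
  rw [e]
  refine lt_of_le_of_lt (norm_add_le _ _) ?_
  linarith

/-- averaged translates -/
lemma fubini_translate {n : ℕ} (x₀ h : EuclideanSpace ℝ (Fin n)) (R s : ℝ) (hRs : R + ‖h‖ ≤ s)
    (f : EuclideanSpace ℝ (Fin n) → ℝ) (hf : ContinuousOn f (closedBall x₀ s))
    (hf0 : ∀ x, 0 ≤ f x) :
    IntegrableOn (fun x => ∫ σ in (0:ℝ)..1, f (x + σ • h)) (ball x₀ R) ∧
    ∫ x in ball x₀ R, ∫ σ in (0:ℝ)..1, f (x + σ • h) ≤ ∫ x in ball x₀ s, f x := by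
  have hmem : ∀ x ∈ closedBall x₀ R, ∀ σ ∈ Set.Icc (0:ℝ) 1, x + σ • h ∈ closedBall x₀ s := by
    intro x hx σ hσ
    rw [mem_closedBall, dist_eq_norm] at hx ⊢
    have e : x + σ • h - x₀ = (x - x₀) + σ • h := by abel
    rw [e]
    refine (norm_add_le _ _).trans ?_
    rw [norm_smul, Real.norm_eq_abs, abs_of_nonneg hσ.1]
    nlinarith [norm_nonneg h, hσ.2]
  have hcont : ContinuousOn (fun z : EuclideanSpace ℝ (Fin n) × ℝ => f (z.1 + z.2 • h))
      (closedBall x₀ R ×ˢ Set.Icc (0:ℝ) 1) := by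
    apply hf.comp (by fun_prop)
    intro z hz
    exact hmem _ hz.1 _ hz.2
  have hintg : Integrable (fun z : EuclideanSpace ℝ (Fin n) × ℝ => f (z.1 + z.2 • h))
      ((volume.restrict (ball x₀ R)).prod (volume.restrict (Set.Ioc (0:ℝ) 1))) := by
    rw [Measure.prod_restrict]
    have := hcont.integrableOn_compact (μ := (volume : Measure (EuclideanSpace ℝ (Fin n))).prod
      (volume : Measure ℝ)) ((isCompact_closedBall x₀ R).prod isCompact_Icc)
    exact this.mono_set (Set.prod_mono ball_subset_closedBall Set.Ioc_subset_Icc_self)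
  simp_rw [intervalIntegral.integral_of_le (zero_le_one (α := ℝ))]
  refine ⟨hintg.integral_prod_left, ?_⟩
  rw [integral_integral_swap hintg]
  have hb : ∀ σ ∈ Set.Ioc (0:ℝ) 1, ∫ x in ball x₀ R, f (x + σ • h) ≤ ∫ x in ball x₀ s, f x := by
    intro σ hσ
    refine translate_le x₀ (σ • h) R s ?_ f hf hf0
    rw [norm_smul, Real.norm_eq_abs, abs_of_nonneg hσ.1.le]
    nlinarith [norm_nonneg h, hσ.2]
  calc _ ≤ ∫ σ in Set.Ioc (0:ℝ) 1, (∫ x in ball x₀ s, f x) := by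
        apply setIntegral_mono_on hintg.integral_prod_right _ measurableSet_Ioc hb
        apply integrableOn_const <;> simp
    _ = _ := by simp

lemma gradient_continuousOn {n : ℕ} {Ω : Set (EuclideanSpace ℝ (Fin n))} (hΩ : IsOpen Ω)
    {u : EuclideanSpace ℝ (Fin n) → ℝ} (hu : ContDiffOn ℝ 1 u Ω) :
    ContinuousOn (gradient u) Ω := by
  have h := hu.continuousOn_fderiv_of_isOpen hΩ le_rfl
  exact (InnerProductSpace.toDual ℝ (EuclideanSpace ℝ (Fin n))).symm.continuous.comp_continuousOn h

lemma hasGradientAt_of {n : ℕ} {Ω : Set (EuclideanSpace ℝ (Fin n))} (hΩ : IsOpen Ω)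
    {u : EuclideanSpace ℝ (Fin n) → ℝ} (hu : ContDiffOn ℝ 1 u Ω) {x} (hx : x ∈ Ω) :
    HasGradientAt u (gradient u x) x :=
  ((hu.contDiffAt (hΩ.mem_nhds hx)).differentiableAt (by simp)).hasGradientAt

/-- FTC + Young -/
lemma ftc_young {n : ℕ} {Ω : Set (EuclideanSpace ℝ (Fin n))} (hΩ : IsOpen Ω)
    {u : EuclideanSpace ℝ (Fin n) → ℝ} (hu : ContDiffOn ℝ 1 u Ω) (q m : ℝ) (hq : 1 < q)
    (hm : 0 ≤ m)
    (hY : ∀ a b : ℝ, 0 ≤ a → 0 ≤ b → a ^ (q - 1) * b ≤ a ^ q + b ^ q)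
    (x h : EuclideanSpace ℝ (Fin n)) (hx : ∀ σ ∈ Set.Icc (0:ℝ) 1, x + σ • h ∈ Ω) :
    m ^ (q - 1) * |u (x + h) - u x| ≤
      ‖h‖ * (m ^ q + ∫ σ in (0:ℝ)..1, ‖gradient u (x + σ • h)‖ ^ q) := by
  have hgc : ContinuousOn (fun σ : ℝ => gradient u (x + σ • h)) (Set.uIcc (0:ℝ) 1) := by
    rw [Set.uIcc_of_le zero_le_one]
    exact (gradient_continuousOn hΩ hu).comp (by fun_prop) hx
  have hd : ∀ σ ∈ Set.uIcc (0:ℝ) 1, HasDerivAt (fun σ : ℝ => u (x + σ • h))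
      (⟪gradient u (x + σ • h), h⟫) σ := by
    intro σ hσ
    rw [Set.uIcc_of_le zero_le_one] at hσ
    have h1 := (hasGradientAt_of hΩ hu (hx σ hσ)).hasFDerivAt
    have h2 : HasDerivAt (fun σ : ℝ => x + σ • h) h σ := by
      simpa using ((hasDerivAt_id σ).smul_const h).const_add x
    have h3 := h1.comp_hasDerivAt σ h2
    rw [InnerProductSpace.toDual_apply_apply] at h3
    exact h3
  have hic : ContinuousOn (fun σ : ℝ => ⟪gradient u (x + σ • h), h⟫) (Set.uIcc (0:ℝ) 1) :=
    hgc.inner continuousOn_const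
  have hF := intervalIntegral.integral_eq_sub_of_hasDerivAt hd hic.intervalIntegrable
  simp only [one_smul, zero_smul, add_zero] at hF
  have hqc : ContinuousOn (fun σ : ℝ => ‖gradient u (x + σ • h)‖ ^ q) (Set.uIcc (0:ℝ) 1) :=
    hgc.norm.rpow_const (fun _ _ => Or.inr (by linarith))
  rw [← hF, ← Real.norm_eq_abs]
  have hb : ‖∫ σ in (0:ℝ)..1, m ^ (q-1) * ⟪gradient u (x + σ • h), h⟫‖ ≤
      ∫ σ in (0:ℝ)..1, ‖h‖ * (m ^ q + ‖gradient u (x + σ • h)‖ ^ q) := by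
    apply intervalIntegral.norm_integral_le_of_norm_le zero_le_one
    · refine Filter.Eventually.of_forall fun σ hσ => ?_
      rw [norm_mul, Real.norm_eq_abs, abs_of_nonneg (by positivity)]
      have h1 : ‖⟪gradient u (x + σ • h), h⟫‖ ≤ ‖gradient u (x + σ • h)‖ * ‖h‖ :=
        norm_inner_le_norm _ _
      have h2 := hY m ‖gradient u (x + σ • h)‖ hm (norm_nonneg _)
      calc _ ≤ m ^ (q-1) * (‖gradient u (x + σ • h)‖ * ‖h‖) := by gcongr
        _ = ‖h‖ * (m ^ (q-1) * ‖gradient u (x + σ • h)‖) := by ring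
        _ ≤ _ := by gcongr
    · exact (continuousOn_const.mul (continuousOn_const.add hqc)).intervalIntegrable
  rw [intervalIntegral.integral_const_mul, norm_mul, Real.norm_eq_abs (m ^ (q-1)),
    abs_of_nonneg (by positivity : 0 ≤ m ^ (q-1)), intervalIntegral.integral_const_mul,
    intervalIntegral.integral_add (by simp) hqc.intervalIntegrable] at hb
  simpa using hb

lemma distSet_mem {n : ℕ} {Ω : Set (EuclideanSpace ℝ (Fin n))}
    {K : Set (EuclideanSpace ℝ (Fin n))} {h : EuclideanSpace ℝ (Fin n)}
    (hh : ‖h‖ < sInf (Set.image2 dist K Ωᶜ)) {x} (hx : x ∈ K) : x + h ∈ Ω := by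
  by_contra hc
  have : sInf (Set.image2 dist K Ωᶜ) ≤ dist x (x + h) := by
    apply csInf_le
    · refine ⟨0, ?_⟩
      rintro _ ⟨a, _, b, _, rfl⟩
      exact dist_nonneg
    · exact ⟨x, hx, x + h, hc, rfl⟩
  rw [dist_self_add_right] at this
  linarith

lemma G_continuousOn {n : ℕ} {Ω : Set (EuclideanSpace ℝ (Fin n))} (L α q : ℝ) (hα : 0 < α)
    (A : EuclideanSpace ℝ (Fin n) → EuclideanSpace ℝ (Fin n) → EuclideanSpace ℝ (Fin n))
    (hA : ∀ x ∈ Ω, Continuous (A x))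
    (hH : ∀ x₁ ∈ Ω, ∀ x₂ ∈ Ω, ∀ z : EuclideanSpace ℝ (Fin n),
          ‖A x₁ z - A x₂ z‖ ≤ L * dist x₁ x₂ ^ α * (1 + ‖z‖ ^ 2) ^ ((q - 1) / 2))
    (D : EuclideanSpace ℝ (Fin n) → EuclideanSpace ℝ (Fin n)) (hD : ContinuousOn D Ω) :
    ContinuousOn (fun x => A x (D x)) Ω := by
  intro x hx
  have hDx := hD x hx
  unfold ContinuousWithinAt at hDx ⊢
  rw [tendsto_iff_norm_sub_tendsto_zero]
  have h1 : Filter.Tendsto (fun y => L * dist y x ^ α * (1 + ‖D y‖ ^ 2) ^ ((q - 1) / 2) +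
      ‖A x (D y) - A x (D x)‖) (nhdsWithin x Ω) (nhds 0) := by
    have hd : Filter.Tendsto (fun y => dist y x) (nhdsWithin x Ω) (nhds 0) := by
      have : Filter.Tendsto (fun y => dist y x) (nhds x) (nhds (dist x x)) :=
        (continuous_id.dist continuous_const).tendsto x
      rw [dist_self] at this
      exact this.mono_left nhdsWithin_le_nhds
    have a1 := (hd.rpow_const (p := α) (Or.inr hα.le)).const_mul L
    rw [Real.zero_rpow hα.ne', mul_zero] at a1
    have a2 := ((hDx.norm.pow 2).const_add 1).rpow_const (p := (q-1)/2)
      (Or.inl (by positivity))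
    have a3 := (((hA x hx).tendsto (D x)).comp hDx).sub_const (A x (D x))
    have a4 := (a1.mul a2).add a3.norm
    simpa using a4
  refine squeeze_zero' (Filter.Eventually.of_forall fun _ => norm_nonneg _) ?_ h1
  filter_upwards [self_mem_nhdsWithin] with y hy
  have : A y (D y) - A x (D x) = (A y (D y) - A x (D y)) + (A x (D y) - A x (D x)) := by abel
  rw [this]
  exact (norm_add_le _ _).trans (by gcongr; exact hH y hy x hx _)

lemma VI_step {n : ℕ} {Ω : Set (EuclideanSpace ℝ (Fin n))} (hΩ : IsOpen Ω)
    {u η : EuclideanSpace ℝ (Fin n) → ℝ} (hu : ContDiffOn ℝ 1 u Ω)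
    {G : EuclideanSpace ℝ (Fin n) → EuclideanSpace ℝ (Fin n)} (hG : ContinuousOn G Ω)
    {x₀ h : EuclideanSpace ℝ (Fin n)} {ρ R : ℝ} (hR : R + ‖h‖ < ρ)
    (hb : closedBall x₀ ρ ⊆ Ω) (hplus : ∀ x ∈ closedBall x₀ ρ, x + h ∈ Ω)
    (hminus : ∀ x ∈ closedBall x₀ ρ, x - h ∈ Ω)
    (hη : ContDiff ℝ 1 η) (hη0 : ∀ x, 0 ≤ η x) (hη1 : ∀ x, η x ≤ 1)
    (hηR : ∀ x ∉ ball x₀ R, η x = 0) (hgR : ∀ x ∉ ball x₀ R, gradient η x = 0)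
    (hu0 : ∀ x ∈ ball x₀ ρ, 0 ≤ u x)
    (hVI : ∀ φ : EuclideanSpace ℝ (Fin n) → ℝ, ContDiffOn ℝ 1 φ (ball x₀ ρ) →
      (∀ x ∈ ball x₀ ρ, 0 ≤ u x + φ x) →
      (∃ K : Set (EuclideanSpace ℝ (Fin n)), IsCompact K ∧ K ⊆ ball x₀ ρ ∧ ∀ x ∉ K, φ x = 0) →
      0 ≤ ∫ x in ball x₀ ρ, ⟪G x, gradient φ x⟫) :
    IntegrableOn (fun x => ⟪G (x + h) - G x,
        η x • (gradient u (x + h) - gradient u x) + (u (x + h) - u x) • gradient η x⟫)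
        (ball x₀ R) ∧
    ∫ x in ball x₀ R, ⟪G (x + h) - G x,
        η x • (gradient u (x + h) - gradient u x) + (u (x + h) - u x) • gradient η x⟫ ≤ 0 := by
  set DΦ : EuclideanSpace ℝ (Fin n) → EuclideanSpace ℝ (Fin n) := fun x =>
    η x • (gradient u (x + h) - gradient u x) + (u (x + h) - u x) • gradient η x with hDΦ
  have hRρ : R < ρ := by linarith [norm_nonneg h]
  have hgu := gradient_continuousOn hΩ hu
  have hcη : Continuous (gradient η) := by
    have := gradient_continuousOn isOpen_univ (contDiffOn_univ.2 hη)
    exact continuousOn_univ.1 this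
  -- gradient of Φ
  have hgrad : ∀ x, x ∈ Ω → x + h ∈ Ω →
      HasGradientAt (fun x => η x * (u (x + h) - u x)) (DΦ x) x := by
    intro x hx hxh
    rw [hasGradientAt_iff_hasFDerivAt]
    have h1 : HasFDerivAt η (fderiv ℝ η x) x := (hη.differentiable (by simp) x).hasFDerivAt
    have h2 := (hasGradientAt_of hΩ hu hx).hasFDerivAt
    have h3 := (hasGradientAt_of hΩ hu hxh).hasFDerivAt
    have h4 := h3.comp x ((hasFDerivAt_id x).add_const h)
    have h5 := h1.mul (h4.sub h2)
    refine h5.congr_fderiv ?_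
    ext z
    simp [hDΦ]
  have hDΦ0 : ∀ x ∉ ball x₀ R, DΦ x = 0 := by
    intro x hx
    simp [hDΦ, hηR x hx, hgR x hx]
  have hcs : closedBall x₀ R ⊆ closedBall x₀ ρ := closedBall_subset_closedBall hRρ.le
  have hmaps : Set.MapsTo (fun x => x + h) (closedBall x₀ R) Ω := fun x hx => hplus x (hcs hx)
  have hsub : closedBall x₀ R ⊆ Ω := hcs.trans hb
  have hDΦc : ContinuousOn DΦ (closedBall x₀ R) := by
    have c1 : ContinuousOn (fun x => gradient u (x + h)) (closedBall x₀ R) :=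
      hgu.comp (by fun_prop) hmaps
    have c2 : ContinuousOn (fun x => u (x + h)) (closedBall x₀ R) :=
      hu.continuousOn.comp (by fun_prop) hmaps
    exact (hη.continuous.continuousOn.smul (c1.sub (hgu.mono hsub))).add
      ((c2.sub (hu.continuousOn.mono hsub)).smul hcη.continuousOn)
  have hGh : ContinuousOn (fun x => G (x + h)) (closedBall x₀ R) :=
      hG.comp (by fun_prop) hmaps
  have hintg : ∀ H : EuclideanSpace ℝ (Fin n) → EuclideanSpace ℝ (Fin n),
      ContinuousOn H (closedBall x₀ R) → IntegrableOn (fun x => ⟪H x, DΦ x⟫) (ball x₀ R) := by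
    intro H hH
    exact ((hH.inner hDΦc).integrableOn_compact (isCompact_closedBall _ _)).mono_set
      ball_subset_closedBall
  refine ⟨hintg _ (hGh.sub (hG.mono hsub)), ?_⟩
  have I1 : 0 ≤ ∫ x in ball x₀ R, ⟪G x, DΦ x⟫ := by
    have := hVI (fun x => η x * (u (x + h) - u x)) ?_ ?_ ?_
    · have e : ∫ x in ball x₀ ρ, ⟪G x, gradient (fun x => η x * (u (x + h) - u x)) x⟫ =
          ∫ x in ball x₀ ρ, ⟪G x, DΦ x⟫ := by
        apply setIntegral_congr_fun measurableSet_ball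
        intro x hx
        have hx' := ball_subset_closedBall hx
        simp only [(hgrad x (hb hx') (hplus x hx')).gradient]
      rw [e, setIntegral_eq_integral_of_forall_compl_eq_zero] at this
      · rwa [setIntegral_eq_integral_of_forall_compl_eq_zero]
        intro x hx; simp [hDΦ0 x hx]
      · intro x hx
        have : x ∉ ball x₀ R := fun hh => hx (ball_subset_ball hRρ.le hh)
        simp [hDΦ0 x this]
    · refine hη.contDiffOn.mul (ContDiffOn.sub ?_ (hu.mono (ball_subset_closedBall.trans hb)))
      exact hu.comp (contDiff_id.add contDiff_const).contDiffOn
        (fun x hx => hplus x (ball_subset_closedBall hx))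
    · intro x hx
      by_cases hxR : x ∈ ball x₀ R
      · have hxh : x + h ∈ ball x₀ ρ := by
          rw [mem_ball, dist_eq_norm] at hxR ⊢
          have e : x + h - x₀ = (x - x₀) + h := by abel
          rw [e]; linarith [norm_add_le (x - x₀) h]
        nlinarith [hu0 x hx, hu0 _ hxh, hη0 x, hη1 x, mul_nonneg (hη0 x) (hu0 _ hxh),
          mul_nonneg (sub_nonneg.2 (hη1 x)) (hu0 x hx)]
      · simp [hηR x hxR, hu0 x hx]
    · refine ⟨closedBall x₀ R, isCompact_closedBall _ _, closedBall_subset_ball hRρ, ?_⟩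
      intro x hx
      have : x ∉ ball x₀ R := fun hh => hx (ball_subset_closedBall hh)
      simp [hηR x this]
  have I2 : ∫ x in ball x₀ R, ⟪G (x + h), DΦ x⟫ ≤ 0 := by
    have hout : ∀ x ∉ ball x₀ ρ, x - h ∉ ball x₀ R := by
      intro x hx hh
      apply hx
      rw [mem_ball, dist_eq_norm] at hh ⊢
      have e : x - x₀ = (x - h - x₀) + h := by abel
      rw [e]; linarith [norm_add_le (x - h - x₀) h]
    have := hVI (fun x => -(η (x - h) * (u x - u (x - h)))) ?_ ?_ ?_
    · have e : ∫ x in ball x₀ ρ, ⟪G x, gradient (fun x => -(η (x - h) * (u x - u (x - h)))) x⟫ =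
          ∫ x in ball x₀ ρ, -⟪G x, DΦ (x - h)⟫ := by
        apply setIntegral_congr_fun measurableSet_ball
        intro x hx
        have hx' := ball_subset_closedBall hx
        have g1 := hgrad (x - h) (hminus x hx') (by simpa using hb hx')
        have g2 : HasGradientAt (fun x => -(η (x - h) * (u x - u (x - h)))) (- DΦ (x - h)) x := by
          rw [hasGradientAt_iff_hasFDerivAt] at g1 ⊢
          have g3 := (g1.comp x ((hasFDerivAt_id x).sub_const h)).neg
          have g4 : (-((fun x => η x * (u (x + h) - u x)) ∘ fun x => id x - h)) =
            (fun x => -(η (x - h) * (u x - u (x - h)))) := by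
            ext y; simp
          rw [g4] at g3
          refine g3.congr_fderiv ?_
          ext z; simp
        simp only [g2.gradient, inner_neg_right]
      rw [e, integral_neg, setIntegral_eq_integral_of_forall_compl_eq_zero] at this
      · rw [← integral_add_right_eq_self _ h] at this
        simp only [add_sub_cancel_right] at this
        rw [setIntegral_eq_integral_of_forall_compl_eq_zero]
        · linarith
        · intro x hx; simp [hDΦ0 x hx]
      · intro x hx
        simp [hDΦ0 _ (hout x hx)]
    · have hm : Set.MapsTo (fun x => x - h) (ball x₀ ρ) Ω :=
        fun x hx => hminus x (ball_subset_closedBall hx)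
      refine ((hη.comp (contDiff_id.sub contDiff_const)).contDiffOn.mul
        (ContDiffOn.sub (hu.mono (ball_subset_closedBall.trans hb)) ?_)).neg
      exact hu.comp (contDiff_id.sub contDiff_const).contDiffOn hm
    · intro x hx
      by_cases hxR : x - h ∈ ball x₀ R
      · have hxh : x - h ∈ ball x₀ ρ := ball_subset_ball hRρ.le hxR
        nlinarith [hu0 x hx, hu0 _ hxh, mul_nonneg (hη0 (x - h)) (hu0 _ hxh),
          mul_nonneg (sub_nonneg.2 (hη1 (x - h))) (hu0 x hx)]
      · simp [hηR _ hxR, hu0 x hx]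
    · refine ⟨closedBall (x₀ + h) R, isCompact_closedBall _ _, ?_, ?_⟩
      · intro x hx
        by_contra hc
        rw [mem_closedBall, dist_eq_norm] at hx
        rw [mem_ball, dist_eq_norm] at hc
        have e : x - x₀ = (x - (x₀ + h)) + h := by abel
        rw [e] at hc; linarith [norm_add_le (x - (x₀ + h)) h]
      · intro x hx
        have : x - h ∉ ball x₀ R := by
          intro hh
          apply hx
          rw [mem_ball, dist_eq_norm] at hh
          rw [mem_closedBall, dist_eq_norm]
          have e : x - (x₀ + h) = x - h - x₀ := by abel
          rw [e]; exact hh.le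
        simp [hηR _ this]
  have e : ∫ x in ball x₀ R, ⟪G (x + h) - G x, DΦ x⟫ =
      (∫ x in ball x₀ R, ⟪G (x + h), DΦ x⟫) - ∫ x in ball x₀ R, ⟪G x, DΦ x⟫ := by
    simp_rw [inner_sub_left]
    exact integral_sub (hintg _ hGh) (hintg _ (hG.mono hsub))
  rw [e]
  linarith

lemma pointwise {n : ℕ} (G0 G1 Am z0 z1 P g : EuclideanSpace ℝ (Fin n))
    (k W e L H q m m0 m1 M' hn J T : ℝ) (hq : 1 < q) (he0 : 0 ≤ e) (he1 : e ≤ 1)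
    (hL : 0 < L) (hH : 0 < H) (hm : 0 ≤ m) (hM' : 0 ≤ M')
    (hmono : k * W ≤ ⟪G1 - Am, z1 - z0⟫)
    (hG0 : ‖G0‖ ≤ L * m0) (hG1 : ‖G1‖ ≤ L * m1) (hAm : ‖Am - G0‖ ≤ L * H * m0)
    (hm0 : m0 ≤ m ^ (q - 1)) (hm1 : m1 ≤ m ^ (q - 1)) (hz : ‖z1 - z0‖ ≤ m) (hg : ‖g‖ ≤ M')
    (hT : m ^ (q - 1) * |T| ≤ hn * (m ^ q + J)) :
    e * (k * W) ≤ ⟪G1 - G0, e • ((z1 - z0) - P) + T • g⟫ +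
      ((3 * L * H + 2 * L * M' * hn) * m ^ q + 2 * L * H / H ^ q * ‖P‖ ^ q
        + 2 * L * M' * hn * J) := by
  have hmq0 : 0 ≤ m ^ (q - 1) := by positivity
  have hmm : m ^ q = m ^ (q - 1) * m := by
    rw [← Real.rpow_add_one' hm (by linarith)]; congr 1; ring
  have hGG : ‖G1 - G0‖ ≤ 2 * L * m ^ (q - 1) := by
    have h1 : L * m0 ≤ L * m ^ (q-1) := by gcongr
    have h2 : L * m1 ≤ L * m ^ (q-1) := by gcongr
    linarith [norm_sub_le G1 G0]
  have t1 : -⟪Am - G0, z1 - z0⟫ ≤ L * H * m ^ q := by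
    have h1 := abs_real_inner_le_norm (Am - G0) (z1 - z0)
    have h2 : ‖Am - G0‖ * ‖z1 - z0‖ ≤ (L * H * m ^ (q - 1)) * m := by
      have : L * H * m0 ≤ L * H * m ^ (q-1) := by gcongr
      gcongr
      exact hAm.trans this
    rw [hmm]
    linarith [neg_abs_le (⟪Am - G0, z1 - z0⟫)]
  have t2 : ⟪G1 - G0, P⟫ ≤ 2 * L * H * m ^ q + 2 * L * H / H ^ q * ‖P‖ ^ q := by
    have h1 := real_inner_le_norm (G1 - G0) P
    have h2 := aux_mul_rpow q m (‖P‖ / H) hq hm (by positivity)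
    rw [Real.div_rpow (norm_nonneg _) hH.le] at h2
    calc _ ≤ ‖G1 - G0‖ * ‖P‖ := h1
      _ ≤ (2 * L * m ^ (q-1)) * ‖P‖ := by gcongr
      _ = 2 * L * H * (m ^ (q-1) * (‖P‖ / H)) := by field_simp
      _ ≤ 2 * L * H * (m ^ q + ‖P‖ ^ q / H ^ q) := by gcongr
      _ = _ := by ring
  have t3 : -(T * ⟪G1 - G0, g⟫) ≤ 2 * L * M' * hn * (m ^ q + J) := by
    have h1 := abs_real_inner_le_norm (G1 - G0) g
    have h2 : |T * ⟪G1 - G0, g⟫| ≤ |T| * ((2 * L * m ^ (q-1)) * M') := by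
      rw [abs_mul]
      gcongr
      refine h1.trans ?_
      gcongr
    have h3 : 2 * L * M' * (m ^ (q - 1) * |T|) ≤ 2 * L * M' * (hn * (m ^ q + J)) := by gcongr
    have h4 := neg_abs_le (T * ⟪G1 - G0, g⟫)
    nlinarith
  have hpos1 : 0 ≤ L * H * m ^ q := by positivity
  have hpos2 : 0 ≤ 2 * L * H * m ^ q + 2 * L * H / H ^ q * ‖P‖ ^ q := by positivity
  have s1 : e * (-⟪Am - G0, z1 - z0⟫) ≤ L * H * m ^ q := by nlinarith
  have s2 : e * ⟪G1 - G0, P⟫ ≤ 2 * L * H * m ^ q + 2 * L * H / H ^ q * ‖P‖ ^ q := by nlinarith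
  have s0 : e * (k * W) ≤ e * ⟪G1 - Am, z1 - z0⟫ := by gcongr
  have id1 : ⟪G1 - G0, e • ((z1 - z0) - P) + T • g⟫ =
      e * ⟪G1 - Am, z1 - z0⟫ + e * ⟪Am - G0, z1 - z0⟫ - e * ⟪G1 - G0, P⟫ + T * ⟪G1 - G0, g⟫ := by
    have : G1 - G0 = (G1 - Am) + (Am - G0) := by abel
    rw [inner_add_right, inner_smul_right, inner_smul_right, inner_sub_right]
    have h2 : ⟪G1 - G0, z1 - z0⟫ = ⟪G1 - Am, z1 - z0⟫ + ⟪Am - G0, z1 - z0⟫ := by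
      rw [← inner_add_left, ← this]
    rw [h2]; ring
  rw [id1]
  linarith


lemma const_final (L M Q κ I a dd B E4 E2 EC : ℝ) (hL : 0 < L) (hM : 0 < M) (hQ0 : 0 < Q)
    (hκ0 : 0 ≤ κ) (hI0 : 0 ≤ I) (hE4 : 0 < E4) (hE2 : 0 < E2) (hEC : 0 < EC)
    (ha1 : a ≤ (3 * L + 4 * L * M) * Q) (hd1 : dd ≤ 4 * L * M * Q)
    (hb1 : B ≤ 2 * L * EC * Q) :
    a * E4 * (κ + 2 * I) + B + dd * (E2 * I) ≤
      ((3 * L + 4 * L * M) * E4 * (κ + 2) + 2 * L * EC + 4 * L * M * E2) * Q * (1 + I) := by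
  have f1 : a * E4 * (κ + 2 * I) ≤ ((3 * L + 4 * L * M) * Q) * E4 * ((κ + 2) * (1 + I)) := by
    have g : κ + 2 * I ≤ (κ + 2) * (1 + I) := by nlinarith [mul_nonneg hκ0 hI0]
    gcongr
  have f2 : B ≤ 2 * L * EC * Q * (1 + I) :=
    hb1.trans (le_mul_of_one_le_right (by positivity) (by linarith))
  have f3 : dd * (E2 * I) ≤ (4 * L * M * Q) * (E2 * (1 + I)) := by
    have g : I ≤ 1 + I := by linarith
    gcongr
  calc _ ≤ _ := add_le_add (add_le_add f1 f2) f3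
    _ = _ := by ring

set_option maxHeartbeats 2000000 in
/-- The fractional Caccioppoli estimate (7) for the gradient of a solution of a
non-autonomous obstacle problem with `(p,q)`-growth:
`∫_{B_t} |τ_h(V_{μ,p}(Dv))|² dx ≤ c |h|^α (s−t)⁻¹ [1 + ∫_{B_s} (|Dv|^q + |Dψ|^q) dx]`,
with `c = c(n,ν,L,p,q,α,A)`. -/
theorem stmt0 (n : ℕ) (hn : 2 ≤ n) (p q α ν L CA : ℝ)
    (hp : 1 < p) (hpq : p ≤ q) (hα : α ∈ Set.Ioc (0 : ℝ) 1)
    (hν : 0 < ν) (hνL : ν ≤ L) (hCA : 1 ≤ CA) :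
    ∃ c : ℝ, 0 < c ∧
      ∀ μ : ℝ, μ ∈ Set.Icc (0 : ℝ) 1 →
      ∀ Ω : Set (EuclideanSpace ℝ (Fin n)), IsOpen Ω →
      ∀ (x₀ : EuclideanSpace ℝ (Fin n)) (ρ : ℝ), 0 < ρ → ρ ≤ 1 →
        closure (ball x₀ ρ) ⊆ Ω →
      ∀ (F : EuclideanSpace ℝ (Fin n) → EuclideanSpace ℝ (Fin n) → ℝ)
        (A : EuclideanSpace ℝ (Fin n) → EuclideanSpace ℝ (Fin n) →
          EuclideanSpace ℝ (Fin n)),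
        -- `z ↦ F(x,z)` is continuously differentiable with gradient `A(x,·)`
        (∀ x ∈ Ω, ContDiff ℝ 1 (F x)) →
        (∀ x ∈ Ω, ∀ z, A x z = gradient (F x) z) →
        -- `A` is measurable in `x`
        (∀ z, Measurable fun x => A x z) →
        -- (i) monotonicity
        (∀ x ∈ Ω, ∀ z₁ z₂ : EuclideanSpace ℝ (Fin n), z₁ ≠ z₂ →
          ν * (μ ^ 2 + ‖z₁‖ ^ 2 + ‖z₂‖ ^ 2) ^ ((p - 2) / 2) * ‖z₁ - z₂‖ ^ 2 ≤
            ⟪A x z₁ - A x z₂, z₁ - z₂⟫) →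
        -- (ii) growth
        (∀ x ∈ Ω, ∀ z : EuclideanSpace ℝ (Fin n),
          ‖A x z‖ ≤ L * (1 + ‖z‖ ^ 2) ^ ((q - 1) / 2)) →
        -- (iii) Hölder continuity in `x`
        (∀ x₁ ∈ Ω, ∀ x₂ ∈ Ω, ∀ z : EuclideanSpace ℝ (Fin n),
          ‖A x₁ z - A x₂ z‖ ≤ L * dist x₁ x₂ ^ α * (1 + ‖z‖ ^ 2) ^ ((q - 1) / 2)) →
      ∀ ψ v : EuclideanSpace ℝ (Fin n) → ℝ,
        ContDiffOn ℝ 1 ψ Ω → ContDiffOn ℝ 1 v Ω →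
        (∀ x ∈ ball x₀ ρ, ψ x ≤ v x) →
        IntegrableOn (fun x => ‖gradient v x‖ ^ q + ‖gradient ψ x‖ ^ q) (ball x₀ ρ) →
        -- the variational inequality
        (∀ w : EuclideanSpace ℝ (Fin n) → ℝ, ContDiffOn ℝ 1 w (ball x₀ ρ) →
          (∀ x ∈ ball x₀ ρ, ψ x ≤ w x) →
          (∃ K : Set (EuclideanSpace ℝ (Fin n)), IsCompact K ∧ K ⊆ ball x₀ ρ ∧
            ∀ x ∉ K, w x = v x) →
          0 ≤ ∫ x in ball x₀ ρ, ⟪A x (gradient v x), gradient w x - gradient v x⟫) →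
        -- the Nikol'skii estimate for the obstacle
        (∀ h : EuclideanSpace ℝ (Fin n), 0 < ‖h‖ →
          ‖h‖ < (1 / 4) * distSet (closure (ball x₀ ρ)) Ωᶜ →
          (∫ x in ball x₀ ρ, ‖gradient ψ (x + h) - gradient ψ x‖ ^ q) ^ (1 / q) ≤
            CA * ‖h‖ ^ α) →
      ∀ t s : ℝ, ρ / 2 ≤ t → t < s → s ≤ ρ →
      ∀ h : EuclideanSpace ℝ (Fin n), 0 < ‖h‖ →
        ‖h‖ < (1 / 1000) * min (s - t) (distSet (closure (ball x₀ ρ)) Ωᶜ) →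
        ∫ x in ball x₀ t, ‖Vmap μ p (gradient v (x + h)) - Vmap μ p (gradient v x)‖ ^ 2 ≤
          c * ‖h‖ ^ α / (s - t) *
            (1 + ∫ x in ball x₀ s, (‖gradient v x‖ ^ q + ‖gradient ψ x‖ ^ q)) := by
  obtain ⟨M, hM, hcut⟩ := cutoff
  have hq : 1 < q := lt_of_lt_of_le hp hpq
  have hL : 0 < L := lt_of_lt_of_le hν hνL
  set κ : ℝ := volume.real (ball (0 : EuclideanSpace ℝ (Fin n)) 1) with hκ
  have hκ0 : 0 ≤ κ := measureReal_nonneg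
  set CV : ℝ := (1 + p) ^ 2 * 2 ^ (|p - 2| / 2) with hCV
  have hCV0 : 0 < CV := by positivity
  set k : ℝ := ν / CV with hk
  have hk0 : 0 < k := by positivity
  set C : ℝ := (3 * L + 4 * L * M) * 4 ^ q * (κ + 2) + 2 * L * CA ^ q + 4 * L * M * 2 ^ q with hC
  have hC0 : 0 < C := by positivity
  refine ⟨C / k, by positivity, ?_⟩
  intro μ hμ Ω hΩ x₀ ρ hρ hρ1 hcl F A hF hAF _ hmono hgrow hhold ψ v hψ hv hobs _ hVI hNik
    t s hts1 hts hsρ h hh0 hhs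
  set d := distSet (closure (ball x₀ ρ)) Ωᶜ with hd
  rw [closure_ball x₀ hρ.ne'] at hcl
  have hd' : d = sInf (Set.image2 dist (closedBall x₀ ρ) Ωᶜ) := by
    rw [hd, distSet, closure_ball x₀ hρ.ne']
  have hδ : 0 < s - t := by linarith
  have hhδ : ‖h‖ < (1/1000) * (s - t) :=
    hhs.trans_le (by gcongr; exact min_le_left _ _)
  have hhd1 : ‖h‖ < (1/1000) * d :=
    hhs.trans_le (by gcongr; exact min_le_right _ _)
  have hhd : ‖h‖ < d := by linarith
  have ht0 : 0 < t := by linarith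
  have hδ1 : s - t ≤ 1 := by linarith
  have hh1 : ‖h‖ ≤ 1 := by linarith
  set R : ℝ := (s + t) / 2 with hR
  have htR : t < R := by rw [hR]; linarith
  have hRs : R + ‖h‖ ≤ s := by rw [hR]; linarith
  have hRs' : R ≤ s := by linarith
  have hRρ : R + ‖h‖ < ρ := by rw [hR]; linarith
  obtain ⟨η, hη, hη0, hη1, hηt, hηR, hgR, hgb⟩ := hcut n x₀ t R ht0 htR
  have hplus : ∀ x ∈ closedBall x₀ ρ, x + h ∈ Ω := fun x hx =>
    distSet_mem (by rw [← hd']; exact hhd) hx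
  have hminus : ∀ x ∈ closedBall x₀ ρ, x - h ∈ Ω := fun x hx => by
    rw [sub_eq_add_neg]
    exact distSet_mem (by rw [← hd', norm_neg]; exact hhd) hx
  have hgv := gradient_continuousOn hΩ hv
  have hgψ := gradient_continuousOn hΩ hψ
  -- continuity of the composed field
  have hAc : ∀ x ∈ Ω, Continuous (A x) := by
    intro x hx
    have e : A x = gradient (F x) := funext (hAF x hx)
    rw [e]
    exact continuousOn_univ.1 (gradient_continuousOn isOpen_univ (contDiffOn_univ.2 (hF x hx)))
  have hG : ContinuousOn (fun x => A x (gradient v x)) Ω :=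
    G_continuousOn L α q hα.1 A hAc hhold (gradient v) hgv
  set u : EuclideanSpace ℝ (Fin n) → ℝ := fun x => v x - ψ x with hu_def
  have hu : ContDiffOn ℝ 1 u Ω := hv.sub hψ
  have hgu : ∀ x ∈ Ω, gradient u x = gradient v x - gradient ψ x := by
    intro x hx
    apply HasGradientAt.gradient
    rw [hasGradientAt_iff_hasFDerivAt]
    have h1 := (hasGradientAt_of hΩ hv hx).hasFDerivAt.sub (hasGradientAt_of hΩ hψ hx).hasFDerivAt
    refine h1.congr_fderiv ?_
    ext z; simp
  have hVI' : ∀ φ : EuclideanSpace ℝ (Fin n) → ℝ, ContDiffOn ℝ 1 φ (ball x₀ ρ) →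
      (∀ x ∈ ball x₀ ρ, 0 ≤ u x + φ x) →
      (∃ K : Set (EuclideanSpace ℝ (Fin n)), IsCompact K ∧ K ⊆ ball x₀ ρ ∧ ∀ x ∉ K, φ x = 0) →
      0 ≤ ∫ x in ball x₀ ρ, ⟪A x (gradient v x), gradient φ x⟫ := by
    intro φ hφ hφ0 ⟨K, hK, hKb, hKφ⟩
    have hsub : ball x₀ ρ ⊆ Ω := ball_subset_closedBall.trans hcl
    have := hVI (fun x => v x + φ x) ((hv.mono hsub).add hφ) ?_ ⟨K, hK, hKb, ?_⟩
    · refine this.trans_eq ?_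
      apply setIntegral_congr_fun measurableSet_ball
      intro x hx
      have : gradient (fun x => v x + φ x) x = gradient v x + gradient φ x := by
        apply HasGradientAt.gradient
        rw [hasGradientAt_iff_hasFDerivAt]
        have h1 := (hasGradientAt_of hΩ hv (hsub hx)).hasFDerivAt.add
          (hasGradientAt_of isOpen_ball hφ hx).hasFDerivAt
        refine h1.congr_fderiv ?_
        ext z; simp
      simp only [this, add_sub_cancel_left]
    · intro x hx
      have := hφ0 x hx
      simp only [hu_def] at this
      linarith
    · intro x hx; simp [hKφ x hx]
  obtain ⟨hDint, hDle⟩ := VI_step hΩ hu hG hRρ hcl hplus hminus hη hη0 hη1 hηR hgR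
    (fun x hx => sub_nonneg.2 (hobs x hx)) hVI'
  set D : EuclideanSpace ℝ (Fin n) → ℝ := fun x =>
    ⟪A (x + h) (gradient v (x + h)) - A x (gradient v x),
        η x • (gradient u (x + h) - gradient u x) + (u (x + h) - u x) • gradient η x⟫ with hD
  set H : ℝ := ‖h‖ ^ α with hH
  have hH0 : 0 < H := by positivity
  set M' : ℝ := M / (R - t) with hM'
  have hM'0 : 0 ≤ M' := div_nonneg hM.le (by linarith)
  set J : EuclideanSpace ℝ (Fin n) → ℝ := fun x => ∫ σ in (0:ℝ)..1, ‖gradient u (x + σ • h)‖ ^ q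
    with hJ
  set a : ℝ := 3 * L * H + 2 * L * M' * ‖h‖ with ha
  set b : ℝ := 2 * L * H / H ^ q with hb
  set dd : ℝ := 2 * L * M' * ‖h‖ with hdd
  have ha0 : 0 ≤ a := by positivity
  have hb0 : 0 ≤ b := by positivity
  have hdd0 : 0 ≤ dd := by positivity
  set fv : EuclideanSpace ℝ (Fin n) → ℝ := fun x => ‖gradient v x‖ ^ q with hfv
  set fψ : EuclideanSpace ℝ (Fin n) → ℝ := fun x => ‖gradient ψ x‖ ^ q with hfψ
  set fu : EuclideanSpace ℝ (Fin n) → ℝ := fun x => ‖gradient u x‖ ^ q with hfu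
  set fP : EuclideanSpace ℝ (Fin n) → ℝ := fun x => ‖gradient ψ (x + h) - gradient ψ x‖ ^ q with hfP
  set Rem : EuclideanSpace ℝ (Fin n) → ℝ := fun x =>
    a * 4 ^ q * (1 + fv x + fv (x + h)) + b * fP x + dd * J x with hRem
  have hsub : ∀ r ≤ ρ, closedBall x₀ r ⊆ Ω := fun r hr =>
    (closedBall_subset_closedBall hr).trans hcl
  have hRρ' : R ≤ ρ := by linarith
  -- pointwise estimate
  have hpt : ∀ x ∈ ball x₀ R, η x *
      (k * ‖Vmap μ p (gradient v (x + h)) - Vmap μ p (gradient v x)‖ ^ 2) ≤ D x + Rem x := by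
    intro x hx
    have hxρ : x ∈ closedBall x₀ ρ := ball_subset_closedBall (ball_subset_ball hRρ' hx)
    have hxΩ := hcl hxρ
    have hxh := hplus x hxρ
    set z0 := gradient v x with hz0
    set z1 := gradient v (x + h) with hz1
    set m : ℝ := 2 + ‖z0‖ + ‖z1‖ with hm
    have hm0 : 0 ≤ m := by positivity
    have hseg : ∀ σ ∈ Set.Icc (0:ℝ) 1, x + σ • h ∈ Ω := by
      intro σ hσ
      apply hcl
      rw [mem_ball, dist_eq_norm] at hx
      rw [mem_closedBall, dist_eq_norm]
      have e : x + σ • h - x₀ = (x - x₀) + σ • h := by abel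
      rw [e]
      refine (norm_add_le _ _).trans ?_
      rw [norm_smul, Real.norm_eq_abs, abs_of_nonneg hσ.1]
      nlinarith [norm_nonneg h, hσ.2]
    have hT := ftc_young hΩ hu q m hq hm0 (fun a b ha hb => aux_mul_rpow q a b hq ha hb) x h hseg
    have hg1 : ∀ z : EuclideanSpace ℝ (Fin n), 1 + ‖z‖ ≤ m →
        (1 + ‖z‖ ^ 2) ^ ((q - 1) / 2) ≤ m ^ (q - 1) := by
      intro z hz
      refine (aux_growth q ‖z‖ hq (norm_nonneg _)).trans ?_
      exact Real.rpow_le_rpow (by positivity) hz (by linarith)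
    have hmon : k * ‖Vmap μ p z1 - Vmap μ p z0‖ ^ 2 ≤ ⟪A (x + h) z1 - A (x + h) z0, z1 - z0⟫ := by
      by_cases hz : z1 = z0
      · simp [hz]
      have h1 := V_le p μ hp z1 z0 hz
      have h2 := hmono (x + h) hxh z1 z0 hz
      refine le_trans ?_ h2
      rw [← hCV] at h1
      calc _ ≤ k * (CV * ((μ ^ 2 + ‖z1‖ ^ 2 + ‖z0‖ ^ 2) ^ ((p - 2) / 2) * ‖z1 - z0‖ ^ 2)) := by
            gcongr
        _ = _ := by rw [hk]; field_simp
    have hpw := pointwise (A x z0) (A (x + h) z1) (A (x + h) z0) z0 z1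
      (gradient ψ (x + h) - gradient ψ x) (gradient η x) k
      (‖Vmap μ p z1 - Vmap μ p z0‖ ^ 2) (η x) L H q m _ _ M' ‖h‖ (J x) (u (x + h) - u x)
      hq (hη0 x) (hη1 x) hL hH0 hm0 hM'0 hmon (hgrow x hxΩ z0) (hgrow (x + h) hxh z1)
      (by have := hhold (x + h) hxh x hxΩ z0
          rwa [dist_self_add_left] at this)
      (hg1 z0 (by rw [hm]; linarith [norm_nonneg z1]))
      (hg1 z1 (by rw [hm]; linarith [norm_nonneg z0]))
      (by rw [hm]; linarith [norm_sub_le z1 z0]) (hgb x) hT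
    have e1 : gradient u (x + h) - gradient u x =
        (z1 - z0) - (gradient ψ (x + h) - gradient ψ x) := by
      rw [hgu x hxΩ, hgu _ hxh]; abel
    have hmq := aux_m q ‖z0‖ ‖z1‖ hq (norm_nonneg _) (norm_nonneg _)
    have hmq' : a * m ^ q ≤ a * 4 ^ q * (1 + fv x + fv (x + h)) := by
      rw [mul_assoc]; exact mul_le_mul_of_nonneg_left hmq ha0
    simp only [hD, hRem, e1]
    linarith
  -- integrability of the remainder
  have hq0 : 0 ≤ q := by linarith
  have hvC : ContinuousOn fv Ω := hgv.norm.rpow_const (fun _ _ => Or.inr hq0)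
  have hψC : ContinuousOn fψ Ω := hgψ.norm.rpow_const (fun _ _ => Or.inr hq0)
  have huC : ContinuousOn fu Ω :=
    (gradient_continuousOn hΩ hu).norm.rpow_const (fun _ _ => Or.inr hq0)
  have hmaps : Set.MapsTo (fun x => x + h) (closedBall x₀ ρ) Ω := hplus
  have hPC : ContinuousOn fP (closedBall x₀ ρ) :=
    ((hgψ.comp (by fun_prop) hmaps).sub (hgψ.mono hcl)).norm.rpow_const (fun _ _ => Or.inr hq0)
  have hvhC : ContinuousOn (fun x => fv (x + h)) (closedBall x₀ ρ) :=
    hvC.comp (by fun_prop) hmaps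
  have hInt : ∀ f : EuclideanSpace ℝ (Fin n) → ℝ, ContinuousOn f (closedBall x₀ ρ) →
      ∀ r ≤ ρ, IntegrableOn f (ball x₀ r) := fun f hf r hr =>
    (hf.integrableOn_compact (isCompact_closedBall _ _)).mono_set
      (ball_subset_closedBall.trans (closedBall_subset_closedBall hr))
  have hfv0 : ∀ x, 0 ≤ fv x := fun x => by positivity
  have hfψ0 : ∀ x, 0 ≤ fψ x := fun x => by positivity
  have hfu0 : ∀ x, 0 ≤ fu x := fun x => by positivity
  have hfP0 : ∀ x, 0 ≤ fP x := fun x => by positivity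
  obtain ⟨hJint, hJle⟩ := fubini_translate x₀ h R s hRs fu (huC.mono (hsub s hsρ)) hfu0
  have i1 : IntegrableOn (fun x => 1 + fv x + fv (x + h)) (ball x₀ R) :=
    hInt _ ((continuousOn_const.add (hvC.mono hcl)).add hvhC) R hRρ'
  have i2 : IntegrableOn fP (ball x₀ R) := hInt _ hPC R hRρ'
  have i12 : IntegrableOn (fun x => a * 4 ^ q * (1 + fv x + fv (x + h)) + b * fP x) (ball x₀ R) :=
    (i1.const_mul _).add (i2.const_mul _)
  have hRemInt : IntegrableOn Rem (ball x₀ R) := i12.add (hJint.const_mul _)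
  have hDRint : IntegrableOn (fun x => D x + Rem x) (ball x₀ R) := hDint.add hRemInt
  -- integrate
  set I : ℝ := ∫ x in ball x₀ s, (‖gradient v x‖ ^ q + ‖gradient ψ x‖ ^ q) with hI
  have iv : IntegrableOn fv (ball x₀ s) := hInt _ (hvC.mono hcl) s hsρ
  have iψ : IntegrableOn fψ (ball x₀ s) := hInt _ (hψC.mono hcl) s hsρ
  have ivψ : IntegrableOn (fun x => fv x + fψ x) (ball x₀ s) := iv.add iψ
  have hI0 : 0 ≤ I := integral_nonneg (fun x => add_nonneg (hfv0 x) (hfψ0 x))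
  have hvI : ∫ x in ball x₀ s, fv x ≤ I :=
    integral_mono iv ivψ (fun x => by have := hfψ0 x; simp only; linarith)
  have k1 : ∫ x in ball x₀ R, fv x ≤ I := by
    have := translate_le x₀ 0 R s (by simpa using hRs') fv (hvC.mono (hsub s hsρ)) hfv0
    simp only [add_zero] at this
    linarith
  have k2 : ∫ x in ball x₀ R, fv (x + h) ≤ I :=
    (translate_le x₀ h R s hRs fv (hvC.mono (hsub s hsρ)) hfv0).trans hvI
  have k3 : ∫ x in ball x₀ s, fu x ≤ 2 ^ q * I := by
    rw [hI, ← integral_const_mul]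
    apply setIntegral_mono_on (hInt _ (huC.mono hcl) s hsρ) (ivψ.const_mul _) measurableSet_ball
    intro x hx
    have hxΩ : x ∈ Ω := hsub s hsρ (ball_subset_closedBall hx)
    refine aux_sub q _ _ _ hq (norm_nonneg _) (norm_nonneg _) (norm_nonneg _) ?_
    rw [hgu x hxΩ]
    exact norm_sub_le _ _
  have k4 : ∫ x in ball x₀ R, fP x ≤ (CA * H) ^ q := by
    have h1 : (∫ x in ball x₀ ρ, fP x) ^ (1 / q) ≤ CA * H := hNik h hh0 (by linarith)
    have h0 : 0 ≤ ∫ x in ball x₀ ρ, fP x := integral_nonneg hfP0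
    have h2 : ∫ x in ball x₀ R, fP x ≤ ∫ x in ball x₀ ρ, fP x :=
      setIntegral_mono_set (hInt _ hPC ρ le_rfl) (Filter.Eventually.of_forall hfP0)
        (LE.le.eventuallyLE (ball_subset_ball hRρ'))
    have h3 := Real.rpow_le_rpow (Real.rpow_nonneg h0 _) h1 hq0
    rw [← Real.rpow_mul h0, one_div, inv_mul_cancel₀ (by linarith), Real.rpow_one] at h3
    exact h2.trans h3
  have k5 : volume.real (ball x₀ R) ≤ κ := by
    rw [hκ, measureReal_def, measureReal_def, Measure.addHaar_ball_center]
    apply ENNReal.toReal_mono measure_ball_lt_top.ne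
    exact measure_mono (ball_subset_ball (by linarith))
  have k6 : ∫ x in ball x₀ R, (1 + fv x + fv (x + h)) ≤ κ + 2 * I := by
    have j1 : IntegrableOn (fun _ : EuclideanSpace ℝ (Fin n) => (1:ℝ)) (ball x₀ R) :=
      hInt _ continuousOn_const R hRρ'
    have j2 : IntegrableOn fv (ball x₀ R) := hInt _ (hvC.mono hcl) R hRρ'
    have j3 : IntegrableOn (fun x => fv (x + h)) (ball x₀ R) := hInt _ hvhC R hRρ'
    rw [integral_add (f := fun x => 1 + fv x) (j1.add j2) j3, integral_add j1 j2]
    simp only [integral_const, smul_eq_mul, mul_one, MeasurableSet.univ, measureReal_restrict_apply, Set.univ_inter]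
    linarith
  have k7 : ∫ x in ball x₀ R, Rem x ≤
      a * 4 ^ q * (κ + 2 * I) + b * (CA * H) ^ q + dd * (2 ^ q * I) := by
    rw [hRem]
    rw [integral_add (f := fun x => a * 4 ^ q * (1 + fv x + fv (x + h)) + b * fP x) i12
      (hJint.const_mul _),
      integral_add (f := fun x => a * 4 ^ q * (1 + fv x + fv (x + h))) (i1.const_mul _)
      (i2.const_mul _), integral_const_mul, integral_const_mul, integral_const_mul]
    have := hJle.trans k3
    gcongr
  have k8 : ∫ x in ball x₀ t,
      k * ‖Vmap μ p (gradient v (x + h)) - Vmap μ p (gradient v x)‖ ^ 2 ≤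
      ∫ x in ball x₀ R, Rem x := by
    have htRs : ball x₀ t ⊆ ball x₀ R := ball_subset_ball htR.le
    calc _ ≤ ∫ x in ball x₀ t, (D x + Rem x) := by
          apply integral_mono_of_nonneg
          · exact Filter.Eventually.of_forall fun x => by
              simp only [Pi.zero_apply]; positivity
          · exact hDRint.mono_set htRs
          · filter_upwards [ae_restrict_mem measurableSet_ball] with x hx
            have := hpt x (htRs hx)
            rwa [hηt x hx, one_mul] at this
      _ ≤ ∫ x in ball x₀ R, (D x + Rem x) := by
          apply setIntegral_mono_set hDRint _ (LE.le.eventuallyLE htRs)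
          filter_upwards [ae_restrict_mem measurableSet_ball] with x hx
          refine le_trans ?_ (hpt x hx)
          have := hη0 x
          simp only [Pi.zero_apply]
          positivity
      _ = (∫ x in ball x₀ R, D x) + ∫ x in ball x₀ R, Rem x := integral_add hDint hRemInt
      _ ≤ _ := by linarith
  rw [integral_const_mul] at k8
  -- final constants
  set Q : ℝ := H / (s - t) with hQ
  have hHQ : H ≤ Q := by
    rw [hQ, le_div_iff₀ hδ]; nlinarith
  have hhH : ‖h‖ ≤ H := by
    have := Real.rpow_le_rpow_of_exponent_ge hh0 hh1 hα.2
    rwa [Real.rpow_one] at this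
  have hMh : M' * ‖h‖ ≤ 2 * M * Q := by
    have e : M' = 2 * M / (s - t) := by
      have : R - t = (s - t) / 2 := by rw [hR]; ring
      rw [hM', this]; field_simp
    rw [e, hQ]
    calc _ ≤ 2 * M / (s - t) * H := by gcongr
      _ = _ := by ring
  have hQ0 : 0 < Q := by positivity
  have ha1 : a ≤ (3 * L + 4 * L * M) * Q := by
    have : L * (M' * ‖h‖) ≤ L * (2 * M * Q) := by gcongr
    have : L * H ≤ L * Q := by gcongr
    rw [ha]; linarith
  have hd1 : dd ≤ 4 * L * M * Q := by
    have : L * (M' * ‖h‖) ≤ L * (2 * M * Q) := by gcongr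
    rw [hdd]; linarith
  have hb1 : b * (CA * H) ^ q ≤ 2 * L * CA ^ q * Q := by
    rw [Real.mul_rpow (by linarith) hH0.le, hb]
    calc _ = 2 * L * CA ^ q * H := by field_simp
      _ ≤ _ := by gcongr
  have hfin : a * 4 ^ q * (κ + 2 * I) + b * (CA * H) ^ q + dd * (2 ^ q * I) ≤ C * Q * (1 + I) := by
    exact const_final L M Q κ I a dd _ (4 ^ q) (2 ^ q) (CA ^ q) hL hM hQ0 hκ0 hI0 (by positivity)
      (by positivity) (Real.rpow_pos_of_pos (by linarith) _) ha1 hd1 hb1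
  have hlast := k8.trans (k7.trans hfin)
  have e : C / k * H / (s - t) * (1 + I) = (C * Q * (1 + I)) / k := by rw [hQ]; field_simp
  rw [e, le_div_iff₀ hk0, mul_comm]
  exact hlast
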